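/- Let |W₃⟩ = (|001⟩ + |010⟩ + |100⟩)/√3 be the three-qubit W state (a unit vector in ℂ⁸ ≅ ℂ²⊗ℂ²⊗ℂ²) and ρ_W = |W₃⟩⟨W₃| the corresponding density matrix. Then its second moment of random full three-body correlations equals 11/81: ∫∫∫_{(S²)³} (Tr[ρ_W (σ_u ⊗ σ_v ⊗ σ_w)])² dμ(u) dμ(v) dμ(w) = (1/27) Σ_{i,j,k=1}^{3} (Tr[ρ_W (σ_i ⊗ σ_j ⊗ σ_k)])² = 11/81. -/

import Mathlib

open MeasureTheory Matrix Kronecker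

noncomputable section

abbrev E3 : Type := EuclideanSpace ℝ (Fin 3)

/-- The unit sphere `S²` in `ℝ³`. -/
abbrev S2 : Type := Metric.sphere (0 : E3) 1

/-- The action of a linear isometry (rotation) of `ℝ³` on the unit sphere. -/
def sphereMap (f : E3 ≃ₗᵢ[ℝ] E3) (x : S2) : S2 :=
  ⟨f x, by
    have h : ‖(x : E3)‖ = 1 := by simpa using mem_sphere_zero_iff_norm.mp x.2
    simp [mem_sphere_zero_iff_norm, h]⟩

/-- The three Pauli matrices `σ_x, σ_y, σ_z`. -/
def pauli : Fin 3 → Matrix (Fin 2) (Fin 2) ℂ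
  | 0 => !![0, 1; 1, 0]
  | 1 => !![0, -Complex.I; Complex.I, 0]
  | 2 => !![1, 0; 0, -1]

/-- For a direction `u ∈ ℝ³`, the operator `σ_u = u₁σ₁ + u₂σ₂ + u₃σ₃`. -/
def pauliVec (u : Fin 3 → ℝ) : Matrix (Fin 2) (Fin 2) ℂ :=
  ∑ j, (u j : ℂ) • pauli j

/-- The coordinates of a point of the unit sphere `S²`. -/
def coords (x : S2) : Fin 3 → ℝ := fun j => (x : E3) j

/-- The three-qubit W state `|W₃⟩ = (|001⟩ + |010⟩ + |100⟩)/√3` as a vector in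
`ℂ² ⊗ ℂ² ⊗ ℂ² ≅ ℂ⁸`. -/
def wState : Fin 2 × Fin 2 × Fin 2 → ℂ := fun x =>
  if x = (0, 0, 1) ∨ x = (0, 1, 0) ∨ x = (1, 0, 0) then ((Real.sqrt 3)⁻¹ : ℝ) else 0

/-- The density matrix `ρ_W = |W₃⟩⟨W₃|` of the three-qubit W state. -/
def rhoW : Matrix (Fin 2 × Fin 2 × Fin 2) (Fin 2 × Fin 2 × Fin 2) ℂ :=
  Matrix.vecMulVec wState (star wState)

lemma continuous_coords_apply (i : Fin 3) : Continuous fun x : S2 => coords x i := by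
  unfold coords
  fun_prop

lemma continuous_sphereMap (f : E3 ≃ₗᵢ[ℝ] E3) : Continuous (sphereMap f) := by
  unfold sphereMap
  exact (f.continuous.comp continuous_subtype_val).subtype_mk _

lemma sum_coords_sq (x : S2) : ∑ i, coords x i ^ 2 = 1 := by
  have h : ‖(x : E3)‖ = 1 := mem_sphere_zero_iff_norm.mp x.2
  rw [EuclideanSpace.norm_eq, Real.sqrt_eq_one] at h
  simpa [coords] using h

lemma Continuous.integrable_of_compactSpace {X : Type*} [TopologicalSpace X] [CompactSpace X]
    [MeasurableSpace X] [OpensMeasurableSpace X] {ν : Measure X} [IsFiniteMeasure ν] {g : X → ℝ}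
    (hg : Continuous g) : Integrable g ν :=
  hg.integrable_of_hasCompactSupport (HasCompactSupport.of_compactSpace g)

section RotationInvariant

variable {μ : Measure S2}

lemma integral_comp_sphereMap (hinv : ∀ f : E3 ≃ₗᵢ[ℝ] E3, μ.map (sphereMap f) = μ)
    (f : E3 ≃ₗᵢ[ℝ] E3) {g : S2 → ℝ} (hg : Continuous g) :
    ∫ x, g (sphereMap f x) ∂μ = ∫ x, g x ∂μ := by
  conv_rhs => rw [← hinv f]
  exact (integral_map (continuous_sphereMap f).aemeasurable hg.aestronglyMeasurable).symm

lemma integral_coords_mul_of_ne (hinv : ∀ f : E3 ≃ₗᵢ[ℝ] E3, μ.map (sphereMap f) = μ)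
    {i j : Fin 3} (hij : i ≠ j) : ∫ x, coords x i * coords x j ∂μ = 0 := by
  let f : E3 ≃ₗᵢ[ℝ] E3 := LinearIsometryEquiv.piLpCongrRight 2 fun k =>
    if k = i then LinearIsometryEquiv.neg ℝ else LinearIsometryEquiv.refl ℝ ℝ
  have h := integral_comp_sphereMap hinv f (g := fun x => coords x i * coords x j)
    ((continuous_coords_apply i).mul (continuous_coords_apply j))
  have hf (x : S2) : coords (sphereMap f x) i * coords (sphereMap f x) j =
      -(coords x i * coords x j) := by
    simp [coords, sphereMap, f, hij.symm]
  simp only [hf, integral_neg] at h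
  linarith

variable [IsProbabilityMeasure μ]

lemma integral_coords_sq (hinv : ∀ f : E3 ≃ₗᵢ[ℝ] E3, μ.map (sphereMap f) = μ) (i : Fin 3) :
    ∫ x, coords x i ^ 2 ∂μ = 1 / 3 := by
  have hswap (j : Fin 3) : ∫ x, coords x j ^ 2 ∂μ = ∫ x, coords x i ^ 2 ∂μ := by
    rw [← integral_comp_sphereMap hinv
      (LinearIsometryEquiv.piLpCongrLeft 2 ℝ ℝ (Equiv.swap i j))
      (g := fun x => coords x j ^ 2) ((continuous_coords_apply j).pow 2)]
    simp [coords, sphereMap, LinearIsometryEquiv.piLpCongrLeft_apply, Equiv.piCongrLeft'_apply]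
  have hsum : ∑ j, ∫ x, coords x j ^ 2 ∂μ = 1 := by
    have hint (j : Fin 3) : Integrable (fun x => coords x j ^ 2) μ :=
      ((continuous_coords_apply j).pow 2).integrable_of_compactSpace
    rw [← integral_finsetSum _ fun j _ => hint j]
    simp [sum_coords_sq]
  simp only [hswap, Finset.sum_const, Finset.card_univ, Fintype.card_fin, nsmul_eq_mul] at hsum
  push_cast at hsum
  linarith

/-- The second moment of a linear form on the sphere is one third of its squared norm. -/
lemma integral_linear_sq (hinv : ∀ f : E3 ≃ₗᵢ[ℝ] E3, μ.map (sphereMap f) = μ) (a : Fin 3 → ℝ) :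
    ∫ x, (∑ i, coords x i * a i) ^ 2 ∂μ = 1 / 3 * ∑ i, a i ^ 2 := by
  have hint (i j : Fin 3) : Integrable (fun x => coords x i * coords x j * (a i * a j)) μ :=
    (((continuous_coords_apply i).mul (continuous_coords_apply j)).mul
      continuous_const).integrable_of_compactSpace
  have hexpand (x : S2) : (∑ i, coords x i * a i) ^ 2 =
      ∑ i, ∑ j, coords x i * coords x j * (a i * a j) := by
    rw [sq, Finset.sum_mul_sum]
    exact Finset.sum_congr rfl fun i _ => Finset.sum_congr rfl fun j _ => by ring
  simp only [hexpand]
  rw [integral_finsetSum _ fun i _ => integrable_finsetSum _ fun j _ => hint i j, Finset.mul_sum]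
  refine Finset.sum_congr rfl fun i _ => ?_
  rw [integral_finsetSum _ fun j _ => hint i j, Finset.sum_eq_single i]
  · rw [integral_mul_const]
    simp only [← sq, integral_coords_sq hinv]
  · intro j _ hj
    rw [integral_mul_const, integral_coords_mul_of_ne hinv hj.symm, zero_mul]
  · simp

/-- The second moment of a trilinear form over three independent uniform directions. -/
lemma integral_trilinear_sq (hinv : ∀ f : E3 ≃ₗᵢ[ℝ] E3, μ.map (sphereMap f) = μ)
    (T : Fin 3 → Fin 3 → Fin 3 → ℝ) :
    ∫ p : S2 × S2 × S2, (∑ i, coords p.1 i * ∑ j, coords p.2.1 j *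
        ∑ k, coords p.2.2 k * T i j k) ^ 2 ∂(μ.prod (μ.prod μ)) =
      1 / 27 * ∑ i, ∑ j, ∑ k, T i j k ^ 2 := by
  have hc := continuous_coords_apply
  have hinner (i : Fin 3) : ∫ q : S2 × S2,
      (∑ j, coords q.1 j * ∑ k, coords q.2 k * T i j k) ^ 2 ∂(μ.prod μ) =
      1 / 9 * ∑ j, ∑ k, T i j k ^ 2 := by
    rw [integral_prod_symm _ (Continuous.integrable_of_compactSpace (by fun_prop))]
    simp only [integral_linear_sq hinv]
    rw [integral_const_mul, integral_finsetSum _ fun j _ =>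
      Continuous.integrable_of_compactSpace (by fun_prop)]
    simp only [integral_linear_sq hinv, ← Finset.mul_sum]
    ring
  rw [integral_prod_symm _ (Continuous.integrable_of_compactSpace (by fun_prop))]
  simp only [integral_linear_sq hinv]
  rw [integral_const_mul, integral_finsetSum _ fun j _ =>
    Continuous.integrable_of_compactSpace (by fun_prop)]
  simp only [hinner, ← Finset.mul_sum]
  ring

end RotationInvariant

lemma trace_mul_pauliVec_kronecker
    (ρ : Matrix (Fin 2 × Fin 2 × Fin 2) (Fin 2 × Fin 2 × Fin 2) ℂ) (u v w : Fin 3 → ℝ) :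
    (ρ * (pauliVec u ⊗ₖ (pauliVec v ⊗ₖ pauliVec w))).trace.re =
      ∑ i, u i * ∑ j, v j * ∑ k, w k * (ρ * (pauli i ⊗ₖ (pauli j ⊗ₖ pauli k))).trace.re := by
  simp only [pauliVec, Fin.sum_univ_three, add_kronecker, kronecker_add, smul_kronecker,
    kronecker_smul, mul_add, Matrix.mul_smul, trace_add, trace_smul, smul_add,
    Complex.add_re, smul_eq_mul, Complex.re_ofReal_mul]
  ring

lemma trace_rhoW_mul (M : Matrix (Fin 2 × Fin 2 × Fin 2) (Fin 2 × Fin 2 × Fin 2) ℂ) :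
    (rhoW * M).trace = 1 / 3 *
      (M (0, 0, 1) (0, 0, 1) + M (0, 0, 1) (0, 1, 0) + M (0, 0, 1) (1, 0, 0) +
       M (0, 1, 0) (0, 0, 1) + M (0, 1, 0) (0, 1, 0) + M (0, 1, 0) (1, 0, 0) +
       M (1, 0, 0) (0, 0, 1) + M (1, 0, 0) (0, 1, 0) + M (1, 0, 0) (1, 0, 0)) := by
  have h3 : ((√3 : ℝ) : ℂ)⁻¹ * ((√3 : ℝ) : ℂ)⁻¹ = 1 / 3 := by
    rw [← mul_inv, ← Complex.ofReal_mul, Real.mul_self_sqrt (by norm_num)]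
    norm_num
  rw [rhoW, vecMulVec_mul, trace_vecMulVec]
  simp [dotProduct, vecMul, Fintype.sum_prod_type, wState]
  linear_combination (M (0, 0, 1) (0, 0, 1) + M (0, 0, 1) (0, 1, 0) + M (0, 0, 1) (1, 0, 0) +
       M (0, 1, 0) (0, 0, 1) + M (0, 1, 0) (0, 1, 0) + M (0, 1, 0) (1, 0, 0) +
       M (1, 0, 0) (0, 0, 1) + M (1, 0, 0) (0, 1, 0) + M (1, 0, 0) (1, 0, 0)) * h3

lemma sum_sq_trace_rhoW_pauli :
    ∑ i : Fin 3, ∑ j : Fin 3, ∑ k : Fin 3,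
      ((rhoW * (pauli i ⊗ₖ (pauli j ⊗ₖ pauli k))).trace).re ^ 2 = 11 / 3 := by
  simp only [trace_rhoW_mul, kroneckerMap_apply, Fin.sum_univ_three, pauli]
  simp
  norm_num

/-- the second moment of random full three-body correlations of the
three-qubit W state equals `11/81`:
`∫∫∫ (Tr[ρ_W (σ_u ⊗ σ_v ⊗ σ_w)])² dμ dμ dμ = (1/27) Σ_{i,j,k} (Tr[ρ_W (σ_i ⊗ σ_j ⊗ σ_k)])² = 11/81`,
where `μ` is the rotation-invariant (uniform) probability measure on `S²`. -/
theorem wState_second_moment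
    (μ : Measure S2) [IsProbabilityMeasure μ]
    (hinv : ∀ f : E3 ≃ₗᵢ[ℝ] E3, μ.map (sphereMap f) = μ) :
    (∫ p : S2 × S2 × S2,
        ((rhoW * (pauliVec (coords p.1) ⊗ₖ (pauliVec (coords p.2.1) ⊗ₖ
          pauliVec (coords p.2.2)))).trace).re ^ 2 ∂(μ.prod (μ.prod μ))) =
      (1 / 27 : ℝ) * ∑ i : Fin 3, ∑ j : Fin 3, ∑ k : Fin 3,
        ((rhoW * (pauli i ⊗ₖ (pauli j ⊗ₖ pauli k))).trace).re ^ 2 ∧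
    (1 / 27 : ℝ) * ∑ i : Fin 3, ∑ j : Fin 3, ∑ k : Fin 3,
        ((rhoW * (pauli i ⊗ₖ (pauli j ⊗ₖ pauli k))).trace).re ^ 2 = 11 / 81 := by
  simp only [trace_mul_pauliVec_kronecker]
  refine ⟨integral_trilinear_sq hinv _, ?_⟩
  rw [sum_sq_trace_rhoW_pauli]
  norm_num
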